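/- arXiv:1902.11256 — 3 statements merged into one kernel-verified Lean document; each statement's English description precedes it below -/
import Mathlib

section
/- Let 𝔤 = ⊕_{k≥1} 𝔤_k be the graded free Lie algebra on a finite set of positively graded generators, and let Φ_1, …, Φ_J, Ω ∈ 𝔤. If exp(Φ_J)⋯exp(Φ_1) ≠ exp(Ω), then there exists q ≥ 1, a nonzero Θ ∈ 𝔤_q, and R in the ideal of series of grade ≥ q+1, such that exp(Φ_J)⋯exp(Φ_1) = exp(Ω) + Θ + R. In other words, the leading term of the difference exp(Φ_J)⋯exp(Φ_1) − exp(Ω) is a homogeneous Lie element. -/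
open scoped BigOperators

namespace NC

/-- The multiplicative identity series (coefficient 1 on the empty word). -/
noncomputable def one {α : Type*} : List α → ℂ
  | [] => 1
  | _ :: _ => 0

/-- Cauchy (convolution) product of noncommutative formal power series,
represented by their coefficient functions on words. -/
noncomputable def mul {α : Type*} (X Y : List α → ℂ) : List α → ℂ :=
  fun w => ∑ i ∈ Finset.range (w.length + 1), X (w.take i) * Y (w.drop i)

/-- Commutator `[X,Y] = XY - YX`. -/
noncomputable def lie {α : Type*} (X Y : List α → ℂ) : List α → ℂ := mul X Y - mul Y X

/-- Powers of a series. -/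
noncomputable def pow {α : Type*} (X : List α → ℂ) : ℕ → (List α → ℂ)
  | 0 => one
  | n + 1 => mul X (pow X n)

/-- The exponential series `∑ Xᵏ/k!`.  For `X` with zero constant term the
coefficient of a word `w` only receives contributions from `k ≤ length w`,
so this finite sum is the exact coefficient of `w` in `exp X`. -/
noncomputable def exp {α : Type*} (X : List α → ℂ) : List α → ℂ :=
  fun w => ∑ k ∈ Finset.range (w.length + 1), ((Nat.factorial k : ℂ))⁻¹ * pow X k w

/-- The generator `a` as a series. -/
noncomputable def gen {α : Type*} [DecidableEq α] (a : α) : List α → ℂ :=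
  fun w => if w = [a] then 1 else 0

/-- Grade of a word: sum of the grades of its letters. -/
def wgrade {α : Type*} (grade : α → ℕ) (w : List α) : ℕ := (w.map grade).sum

/-- Pure Lie elements of a given grade: generators, and brackets of pure elements. -/
inductive IsPure {α : Type*} [DecidableEq α] (grade : α → ℕ) :
    (List α → ℂ) → ℕ → Prop
  | gen (a : α) : IsPure grade (gen a) (grade a)
  | bracket {X Y : List α → ℂ} {k l : ℕ} :
      IsPure grade X k → IsPure grade Y l → IsPure grade (lie X Y) (k + l)

/-- The homogeneous component `𝔤ₖ` of the free Lie algebra: span of pure elements of grade `k`. -/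
noncomputable def gk {α : Type*} [DecidableEq α] (grade : α → ℕ) (k : ℕ) :
    Submodule ℂ (List α → ℂ) :=
  Submodule.span ℂ {X | IsPure grade X k}

/-- `ℛ_q`: series supported on words of grade `≥ q`. -/
def Rset {α : Type*} (grade : α → ℕ) (q : ℕ) : Set (List α → ℂ) :=
  {R | ∀ w : List α, wgrade grade w < q → R w = 0}

/-- Membership in the free Lie algebra `𝔤 = ⊕ₖ 𝔤ₖ`: a finite sum of homogeneous components. -/
def inLie {α : Type*} [DecidableEq α] (grade : α → ℕ) (Φ : List α → ℂ) : Prop :=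
  ∃ (q : ℕ) (X : ℕ → List α → ℂ),
    (∀ k, 1 ≤ k → X k ∈ gk grade k) ∧ Φ = ∑ k ∈ Finset.Icc 1 q, X k

/-- Product of the exponentials of a list of exponents. -/
noncomputable def prodExp {α : Type*} : List (List α → ℂ) → (List α → ℂ)
  | [] => one
  | X :: rest => mul (exp X) (prodExp rest)

/-- The scheme `exp(Φ_J)⋯exp(Φ_1)` associated with exponents `Φ_1, …, Φ_J`. -/
noncomputable def scheme {α : Type*} {J : ℕ} (Φ : Fin J → List α → ℂ) : List α → ℂ :=
  prodExp (List.ofFn Φ).reverse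

/-- Lyndon words: nonempty and lexicographically strictly smaller than each proper right factor. -/
def Lyndon {α : Type*} [LT α] (w : List α) : Prop :=
  w ≠ [] ∧ ∀ i : ℕ, 0 < i → i < w.length → w < w.drop i

/-- The matrix of coefficients of subwords of `w` in a series `X`. -/
noncomputable def phi {α : Type*} (w : List α) (X : List α → ℂ) :
    Matrix (Fin (w.length + 1)) (Fin (w.length + 1)) ℂ :=
  Matrix.of fun i j =>
    if (i : ℕ) < (j : ℕ) then X ((w.drop (i : ℕ)).take ((j : ℕ) - (i : ℕ)))
    else if (i : ℕ) = (j : ℕ) then X []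
    else 0

end NC

namespace NCAux

/-- Type synonym for series, carrying the Cauchy product ring structure. -/
def Ser (α : Type*) := List α → ℂ

variable {α : Type*}

theorem ncmul_nil (X Y : List α → ℂ) : NC.mul X Y [] = X [] * Y [] := by
  simp [NC.mul]

theorem ncmul_cons (X Y : List α → ℂ) (a : α) (w : List α) :
    NC.mul X Y (a :: w) = X [] * Y (a :: w) + NC.mul (fun v => X (a :: v)) Y w := by
  simp only [NC.mul, List.length_cons]
  rw [Finset.sum_range_succ']
  simp [add_comm]

theorem ncmul_add_left (X Y Z : List α → ℂ) :
    NC.mul (X + Y) Z = NC.mul X Z + NC.mul Y Z := by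
  funext w
  simp [NC.mul, add_mul, Finset.sum_add_distrib]

theorem ncmul_add_right (X Y Z : List α → ℂ) :
    NC.mul X (Y + Z) = NC.mul X Y + NC.mul X Z := by
  funext w
  simp [NC.mul, mul_add, Finset.sum_add_distrib]

theorem ncmul_smul_left (c : ℂ) (X Y : List α → ℂ) :
    NC.mul (c • X) Y = c • NC.mul X Y := by
  funext w
  simp [NC.mul, Finset.mul_sum, mul_assoc]

theorem ncmul_smul_right (c : ℂ) (X Y : List α → ℂ) :
    NC.mul X (c • Y) = c • NC.mul X Y := by
  funext w
  simp [NC.mul, Finset.mul_sum, mul_left_comm]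

theorem ncmul_zero (X : List α → ℂ) : NC.mul X 0 = 0 := by
  funext w
  simp [NC.mul]

theorem nczero_mul (X : List α → ℂ) : NC.mul 0 X = 0 := by
  funext w
  simp [NC.mul]

theorem ncone_mul (X : List α → ℂ) : NC.mul NC.one X = X := by
  funext w
  cases w with
  | nil => simp [ncmul_nil, NC.one]
  | cons a w =>
    rw [ncmul_cons]
    have : (fun v : List α => NC.one (a :: v)) = (0 : List α → ℂ) := by
      funext v; simp [NC.one]
    rw [this, nczero_mul]
    simp [NC.one]

theorem ncmul_one (X : List α → ℂ) : NC.mul X NC.one = X := by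
  funext w
  induction w generalizing X with
  | nil => simp [ncmul_nil, NC.one]
  | cons a w ih =>
    rw [ncmul_cons, ih]
    simp [NC.one]

theorem ncmul_assoc (X Y Z : List α → ℂ) :
    NC.mul (NC.mul X Y) Z = NC.mul X (NC.mul Y Z) := by
  funext w
  induction w generalizing X with
  | nil => simp [ncmul_nil, mul_assoc]
  | cons a w ih =>
    rw [ncmul_cons, ncmul_cons X, ncmul_nil, ← ih, ncmul_cons Y]
    have : (fun v => NC.mul X Y (a :: v)) =
        X [] • (fun v => Y (a :: v)) + NC.mul (fun v => X (a :: v)) Y := by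
      funext v
      rw [ncmul_cons]
      simp
    rw [this, ncmul_add_left, ncmul_smul_left]
    simp
    ring

noncomputable instance : AddCommGroup (Ser α) := inferInstanceAs (AddCommGroup (List α → ℂ))
noncomputable instance : Module ℂ (Ser α) := inferInstanceAs (Module ℂ (List α → ℂ))

noncomputable instance : Ring (Ser α) :=
  { (inferInstance : AddCommGroup (Ser α)) with
    mul := fun X Y => NC.mul X Y
    one := NC.one
    mul_assoc := ncmul_assoc
    one_mul := ncone_mul
    mul_one := ncmul_one
    left_distrib := ncmul_add_right
    right_distrib := ncmul_add_left
    zero_mul := nczero_mul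
    mul_zero := ncmul_zero }

noncomputable instance : Algebra ℂ (Ser α) :=
  Algebra.ofModule ncmul_smul_left (fun c X Y => ncmul_smul_right c X Y)

theorem ext' {f g : Ser α} (h : ∀ w, f w = g w) : f = g := funext h

theorem add_ap (f g : Ser α) (w : List α) : (f + g) w = f w + g w := rfl
theorem sub_ap (f g : Ser α) (w : List α) : (f - g) w = f w - g w := rfl
theorem zero_ap (w : List α) : (0 : Ser α) w = 0 := rfl
theorem smul_ap (c : ℂ) (f : Ser α) (w : List α) : (c • f) w = c * f w := rfl
theorem mul_ap (f g : Ser α) (w : List α) :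
    (f * g) w = ∑ i ∈ Finset.range (w.length + 1), f (w.take i) * g (w.drop i) := rfl

/-- evaluation at a word, as a linear map -/
def ev (w : List α) : Ser α →ₗ[ℂ] ℂ where
  toFun f := f w
  map_add' _ _ := rfl
  map_smul' _ _ := rfl

theorem sum_ap {ι : Type*} (s : Finset ι) (f : ι → Ser α) (w : List α) :
    (∑ i ∈ s, f i) w = ∑ i ∈ s, f i w := map_sum (ev w) f s

theorem pow_eq (X : Ser α) (n : ℕ) : (NC.pow X n : Ser α) = X ^ n := by
  induction n with
  | zero => rfl
  | succ n ih => rw [pow_succ', ← ih]; rfl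

/-! ### the key algebraic identity -/

theorem key {A : Type*} [Ring A] [Algebra ℂ A] (δ : A →ₗ[ℂ] A)
    (hδ : ∀ x y, δ (x * y) = δ x * y + x * δ y) (Φ : A) (e a : ℕ → A)
    (he0 : e 0 = 1) (he : ∀ n, Φ * e n = ((n : ℂ) + 1) • e (n + 1))
    (ha0 : a 0 = δ Φ) (ha : ∀ j, Φ * a j - a j * Φ = ((j : ℂ) + 2) • a (j + 1)) (n : ℕ) :
    δ (e (n + 1)) = ∑ p ∈ Finset.HasAntidiagonal.antidiagonal n, a p.1 * e p.2 := by
  have h1 : δ 1 = 0 := by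
    have := hδ 1 1
    simpa using this
  induction n with
  | zero =>
    have := he 0
    simp only [he0, mul_one, Nat.cast_zero, zero_add, one_smul] at this
    simp [← this, ha0, he0]
  | succ n ih =>
    have hn : ((n : ℂ) + 1 + 1) ≠ 0 := by exact_mod_cast Nat.succ_ne_zero (n + 1)
    apply smul_right_injective A hn
    change ((n : ℂ) + 1 + 1) • δ (e (n + 1 + 1)) = ((n : ℂ) + 1 + 1) • _
    have h2 := he (n + 1)
    push_cast at h2
    rw [← map_smul, ← h2, hδ, ih, Finset.mul_sum, ← ha0]
    have h3 : ∀ p ∈ Finset.HasAntidiagonal.antidiagonal n, Φ * (a p.1 * e p.2) =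
        ((p.1 : ℂ) + 2) • (a (p.1 + 1) * e p.2) + ((p.2 : ℂ) + 1) • (a p.1 * e (p.2 + 1)) := by
      intro p _
      rw [← smul_mul_assoc, ← ha, ← mul_smul_comm, ← he]
      noncomm_ring
    have h4 : ((n : ℂ) + 1 + 1) • ∑ p ∈ Finset.HasAntidiagonal.antidiagonal (n + 1), a p.1 * e p.2 =
        ∑ p ∈ Finset.HasAntidiagonal.antidiagonal (n + 1), ((p.1 : ℂ) + 1) • (a p.1 * e p.2) +
        ∑ p ∈ Finset.HasAntidiagonal.antidiagonal (n + 1), (p.2 : ℂ) • (a p.1 * e p.2) := by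
      rw [Finset.smul_sum, ← Finset.sum_add_distrib]
      refine Finset.sum_congr rfl fun p hp => ?_
      rw [← add_smul]
      congr 1
      have := Finset.HasAntidiagonal.mem_antidiagonal.1 hp
      have h : ((p.1 + p.2 : ℕ) : ℂ) = ((n + 1 : ℕ) : ℂ) := by rw [this]
      push_cast at h
      linear_combination -h
    rw [h4, Finset.sum_congr rfl h3, Finset.sum_add_distrib,
      Finset.Nat.sum_antidiagonal_succ, Finset.Nat.sum_antidiagonal_succ']
    simp only [Nat.cast_zero, zero_add, one_smul, zero_smul, Nat.cast_add, Nat.cast_one, add_assoc,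
      one_add_one_eq_two, add_zero]

/-! ### order in word length and limits -/

/-- vanishing on short words -/
def ord (n : ℕ) (f : Ser α) : Prop := ∀ w : List α, w.length < n → f w = 0

theorem ord_mul {m n : ℕ} {f g : Ser α} (hf : ord m f) (hg : ord n g) : ord (m + n) (f * g) := by
  intro w hw
  rw [mul_ap]
  refine Finset.sum_eq_zero fun i hi => ?_
  have hi' := Finset.mem_range.1 hi
  by_cases h : i < m
  · rw [hf _ (by simp; omega), zero_mul]
  · rw [hg _ (by simp; omega), mul_zero]

theorem ord_smul {m : ℕ} {f : Ser α} (c : ℂ) (hf : ord m f) : ord m (c • f) := by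
  intro w hw
  rw [smul_ap, hf w hw, mul_zero]

theorem ord_sub {m : ℕ} {f g : Ser α} (hf : ord m f) (hg : ord m g) : ord m (f - g) := by
  intro w hw
  rw [sub_ap, hf w hw, hg w hw, sub_zero]

theorem ord_pow {f : Ser α} (hf : ord 1 f) (n : ℕ) : ord n (f ^ n) := by
  induction n with
  | zero => intro w hw; omega
  | succ n ih => rw [pow_succ]; exact ord_mul ih hf

/-- infinite sums -/
noncomputable def lim (a : ℕ → Ser α) : Ser α :=
  fun w => ∑ j ∈ Finset.range (w.length + 1), a j w

theorem lim_ap {a : ℕ → Ser α} (ha : ∀ j, ord j (a j)) {w : List α} {N : ℕ} (hN : w.length < N) :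
    lim a w = ∑ j ∈ Finset.range N, a j w := by
  refine Finset.sum_subset (by simpa using hN) fun j _ hj => ha j w ?_
  simp at hj
  omega

theorem lim_mul {a b : ℕ → Ser α} (ha : ∀ j, ord j (a j)) (hb : ∀ j, ord j (b j)) :
    lim a * lim b = lim (fun n => ∑ p ∈ Finset.HasAntidiagonal.antidiagonal n, a p.1 * b p.2) := by
  apply ext'
  intro w
  have h1 : (lim a * lim b) w = ((∑ j ∈ Finset.range (w.length + 1), a j) *
      (∑ j ∈ Finset.range (w.length + 1), b j)) w := by
    rw [mul_ap, mul_ap]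
    refine Finset.sum_congr rfl fun i _ => ?_
    rw [lim_ap ha (N := w.length + 1) (by simp),
      lim_ap hb (N := w.length + 1) (by simp), sum_ap, sum_ap]
  rw [h1, Finset.sum_mul_sum, sum_ap]
  simp only [sum_ap, lim]
  rw [← Finset.sum_product', Finset.sum_sigma']
  symm
  refine Finset.sum_of_injOn (fun x => x.2) ?_ ?_ ?_ ?_
  · rintro ⟨n, p⟩ h ⟨n', p'⟩ h' hh
    simp at h h' hh
    obtain ⟨_, rfl⟩ := h
    obtain ⟨_, rfl⟩ := h'
    subst hh
    rfl
  · rintro ⟨n, p⟩ h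
    simp at h ⊢
    omega
  · rintro ⟨j, m⟩ h h'
    refine ord_mul (ha j) (hb m) w ?_
    by_contra hc
    apply h'
    refine ⟨⟨j + m, (j, m)⟩, ?_, rfl⟩
    simp
    omega
  · intros
    rfl

/-! ### grades -/

variable (grade : α → ℕ)

theorem wgrade_append (u v : List α) :
    NC.wgrade grade (u ++ v) = NC.wgrade grade u + NC.wgrade grade v := by
  simp [NC.wgrade]

theorem wgrade_split (w : List α) (i : ℕ) :
    NC.wgrade grade (w.take i) + NC.wgrade grade (w.drop i) = NC.wgrade grade w := by
  rw [← wgrade_append, List.take_append_drop]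

theorem length_le_wgrade (hpos : ∀ a, 0 < grade a) (w : List α) :
    w.length ≤ NC.wgrade grade w := by
  induction w with
  | nil => simp
  | cons a w ih =>
    have := hpos a
    simp only [NC.wgrade, List.map_cons, List.sum_cons, List.length_cons] at *
    omega

/-- homogeneous component -/
noncomputable def comp (k : ℕ) : Ser α →ₗ[ℂ] Ser α where
  toFun f := fun w => if NC.wgrade grade w = k then f w else 0
  map_add' f g := by
    apply ext'; intro w
    change (if _ then f w + g w else 0) = (if _ then f w else 0) + (if _ then g w else 0)
    split_ifs <;> simp
  map_smul' c f := by
    apply ext'; intro w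
    change (if _ then c * f w else 0) = c * (if _ then f w else 0)
    split_ifs <;> simp

theorem comp_ap (k : ℕ) (f : Ser α) (w : List α) :
    comp grade k f w = if NC.wgrade grade w = k then f w else 0 := rfl

theorem comp_mul (k : ℕ) (f g : Ser α) :
    comp grade k (f * g) =
      ∑ p ∈ Finset.HasAntidiagonal.antidiagonal k, comp grade p.1 f * comp grade p.2 g := by
  apply ext'
  intro w
  rw [comp_ap, sum_ap]
  simp only [mul_ap]
  rw [Finset.sum_comm]
  have h : ∀ i, ∑ p ∈ Finset.HasAntidiagonal.antidiagonal k, comp grade p.1 f (w.take i) * comp grade p.2 g (w.drop i)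
      = if NC.wgrade grade w = k then f (w.take i) * g (w.drop i) else 0 := by
    intro i
    have hs := wgrade_split grade w i
    split_ifs with hk
    · rw [Finset.sum_eq_single (NC.wgrade grade (w.take i), NC.wgrade grade (w.drop i))]
      · simp [comp_ap]
      · rintro ⟨p, q⟩ _ hne
        simp only [comp_ap]
        split_ifs with h1 h2
        · exact absurd (Prod.ext h1.symm h2.symm) hne
        all_goals simp
      · intro hh
        exact absurd (by simp; omega) hh
    · refine Finset.sum_eq_zero fun p hp => ?_
      have := Finset.HasAntidiagonal.mem_antidiagonal.1 hp
      simp only [comp_ap]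
      split_ifs with h1 h2
      · omega
      all_goals simp
  simp only [h]
  split_ifs <;> simp

/-- the grading derivation -/
noncomputable def D : Ser α →ₗ[ℂ] Ser α where
  toFun f := fun w => (NC.wgrade grade w : ℂ) * f w
  map_add' f g := by
    apply ext'; intro w; exact mul_add (NC.wgrade grade w : ℂ) (f w) (g w)
  map_smul' c f := by
    apply ext'; intro w; exact mul_left_comm (NC.wgrade grade w : ℂ) c (f w)

theorem D_ap (f : Ser α) (w : List α) : D grade f w = (NC.wgrade grade w : ℂ) * f w := rfl

theorem D_mul (f g : Ser α) : D grade (f * g) = D grade f * g + f * D grade g := by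
  apply ext'
  intro w
  simp only [D_ap, add_ap, mul_ap]
  rw [Finset.mul_sum, ← Finset.sum_add_distrib]
  refine Finset.sum_congr rfl fun i _ => ?_
  rw [← wgrade_split grade w i]
  push_cast
  ring

/-! ### Lie series -/

variable [DecidableEq α]

theorem gk_lie {k l : ℕ} {X Y : Ser α} (hX : X ∈ NC.gk grade k) (hY : Y ∈ NC.gk grade l) :
    (X * Y - Y * X : Ser α) ∈ NC.gk grade (k + l) := by
  induction hX using Submodule.span_induction with
  | mem X hX =>
    induction hY using Submodule.span_induction with
    | mem Y hY => exact Submodule.subset_span (NC.IsPure.bracket hX hY)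
    | zero =>
      have : ((X : Ser α) * (0 : Ser α) - (0 : Ser α) * X) = 0 := by simp
      have h0 : (0 : Ser α) ∈ NC.gk grade (k + l) := Submodule.zero_mem _
      rw [← this] at h0
      exact h0
    | add Y Z _ _ h1 h2 =>
      have : ((X : Ser α) * ((Y : Ser α) + (Z : Ser α)) - ((Y : Ser α) + (Z : Ser α)) * X) =
        ((X : Ser α) * (Y : Ser α) - (Y : Ser α) * X) +
        ((X : Ser α) * (Z : Ser α) - (Z : Ser α) * X) := by noncomm_ring
      exact this ▸ Submodule.add_mem _ h1 h2
    | smul c Y _ h1 =>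
      have : ((X : Ser α) * (c • (Y : Ser α)) - (c • (Y : Ser α)) * X) =
        c • ((X : Ser α) * (Y : Ser α) - (Y : Ser α) * X) := by
          rw [mul_smul_comm, smul_mul_assoc, smul_sub]
      exact this ▸ Submodule.smul_mem _ c h1
  | zero =>
      have : ((0 : Ser α) * Y - Y * (0 : Ser α)) = 0 := by simp
      have h0 : (0 : Ser α) ∈ NC.gk grade (k + l) := Submodule.zero_mem _
      rw [← this] at h0
      exact h0
  | add U Z _ _ h1 h2 =>
      have : (((U : Ser α) + (Z : Ser α)) * Y - Y * ((U : Ser α) + (Z : Ser α))) =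
        ((U : Ser α) * Y - Y * (U : Ser α)) +
        ((Z : Ser α) * Y - Y * (Z : Ser α)) := by noncomm_ring
      exact this ▸ Submodule.add_mem _ h1 h2
  | smul c U _ h1 =>
      have : ((c • (U : Ser α)) * Y - Y * (c • (U : Ser α))) =
        c • ((U : Ser α) * Y - Y * (U : Ser α)) := by
          rw [mul_smul_comm, smul_mul_assoc, smul_sub]
      exact this ▸ Submodule.smul_mem _ c h1

/-- Lie series -/
def LieSer (f : Ser α) : Prop := ∀ k, comp grade k f ∈ NC.gk grade k

variable {grade}

theorem LieSer.zero : LieSer grade (0 : Ser α) := fun k => by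
  rw [map_zero]; exact Submodule.zero_mem _

theorem LieSer.add {f g : Ser α} (hf : LieSer grade f) (hg : LieSer grade g) :
    LieSer grade (f + g) := fun k => by
  rw [map_add]; exact Submodule.add_mem _ (hf k) (hg k)

theorem LieSer.sub {f g : Ser α} (hf : LieSer grade f) (hg : LieSer grade g) :
    LieSer grade (f - g) := fun k => by
  rw [map_sub]; exact Submodule.sub_mem _ (hf k) (hg k)

theorem LieSer.smul {f : Ser α} (c : ℂ) (hf : LieSer grade f) : LieSer grade (c • f) := fun k => by
  rw [map_smul]; exact Submodule.smul_mem _ c (hf k)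

theorem gk_sum {ι : Type*} (s : Finset ι) (k : ℕ) (f : ι → Ser α)
    (h : ∀ i ∈ s, f i ∈ NC.gk grade k) : (∑ i ∈ s, f i) ∈ NC.gk grade k :=
  Submodule.sum_mem (NC.gk grade k) h

theorem LieSer.sum {ι : Type*} (s : Finset ι) (f : ι → Ser α) (h : ∀ i ∈ s, LieSer grade (f i)) :
    LieSer grade (∑ i ∈ s, f i) := fun k => by
  rw [map_sum]; exact gk_sum _ _ _ fun i hi => h i hi k

theorem LieSer.lie {f g : Ser α} (hf : LieSer grade f) (hg : LieSer grade g) :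
    LieSer grade (f * g - g * f) := fun k => by
  have h : comp grade k (g * f) =
      ∑ p ∈ Finset.HasAntidiagonal.antidiagonal k, comp grade p.2 g * comp grade p.1 f := by
    rw [comp_mul, ← Finset.Nat.sum_antidiagonal_swap]
    rfl
  rw [map_sub, comp_mul, h, ← Finset.sum_sub_distrib]
  refine gk_sum _ _ _ fun p hp => ?_
  rw [← Finset.HasAntidiagonal.mem_antidiagonal.1 hp]
  exact gk_lie grade (hf _) (hg _)

theorem LieSer.D {f : Ser α} (hf : LieSer grade f) : LieSer grade (D grade f) := fun k => by
  have : comp grade k (NCAux.D grade f) = (k : ℂ) • comp grade k f := by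
    apply ext'
    intro w
    simp only [comp_ap, smul_ap, D_ap]
    split_ifs with h
    · rw [h]
    · simp
  rw [this]
  exact Submodule.smul_mem _ _ (hf k)

theorem LieSer.lim (hpos : ∀ a, 0 < grade a) {a : ℕ → Ser α} (ha : ∀ j, ord j (a j))
    (h : ∀ j, LieSer grade (a j)) : LieSer grade (lim a) := fun k => by
  have : comp grade k (NCAux.lim a) = ∑ j ∈ Finset.range (k + 1), comp grade k (a j) := by
    apply ext'
    intro w
    rw [sum_ap]
    simp only [comp_ap]
    split_ifs with hk
    · have := length_le_wgrade grade hpos w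
      exact lim_ap ha (by omega)
    · simp
  rw [this]
  exact gk_sum _ _ _ fun j _ => h j k

theorem pure_nil {X : List α → ℂ} {k : ℕ} (h : NC.IsPure grade X k) : X [] = 0 := by
  induction h with
  | gen a => simp [NC.gen]
  | bracket _ _ h1 h2 => simp [NC.lie, ncmul_nil, h1, h2]

theorem pure_hom {X : List α → ℂ} {k : ℕ} (h : NC.IsPure grade X k) (w : List α)
    (hw : NC.wgrade grade w ≠ k) : X w = 0 := by
  induction h generalizing w with
  | gen a =>
    simp only [NC.gen]
    rw [if_neg]
    rintro rfl
    simp [NC.wgrade] at hw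
  | @bracket X Y k l _ _ h1 h2 =>
    simp only [NC.lie, Pi.sub_apply, NC.mul]
    rw [Finset.sum_eq_zero, Finset.sum_eq_zero, sub_zero]
    all_goals
      intro i _
      have := wgrade_split grade w i
    · by_cases hh : NC.wgrade grade (w.take i) = l
      · rw [h1 (w.drop i) (by omega), mul_zero]
      · rw [h2 _ hh, zero_mul]
    · by_cases hh : NC.wgrade grade (w.take i) = k
      · rw [h2 (w.drop i) (by omega), mul_zero]
      · rw [h1 _ hh, zero_mul]

theorem gk_nil {X : List α → ℂ} {k : ℕ} (h : X ∈ NC.gk grade k) : X [] = 0 := by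
  induction h using Submodule.span_induction with
  | mem X hX => exact pure_nil hX
  | zero => rfl
  | add X Y _ _ h1 h2 => simp [h1, h2]
  | smul c X _ h1 => simp [h1]

theorem gk_hom {X : List α → ℂ} {k : ℕ} (h : X ∈ NC.gk grade k) (w : List α)
    (hw : NC.wgrade grade w ≠ k) : X w = 0 := by
  induction h using Submodule.span_induction with
  | mem X hX => exact pure_hom hX w hw
  | zero => rfl
  | add X Y _ _ h1 h2 => simp [h1, h2]
  | smul c X _ h1 => simp [h1]

theorem LieSer.nil {f : Ser α} (hf : LieSer grade f) : f [] = 0 := by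
  have := gk_nil (hf 0)
  rw [comp_ap] at this
  simpa [NC.wgrade] using this

theorem LieSer.ord {f : Ser α} (hf : LieSer grade f) : ord 1 f := by
  intro w hw
  have : w = [] := by
    apply List.eq_nil_of_length_eq_zero; omega
  rw [this, hf.nil]

theorem LieSer.of_gk {X : Ser α} {k : ℕ} (h : X ∈ NC.gk grade k) : LieSer grade X := fun j => by
  by_cases hj : j = k
  · subst hj
    have : comp grade j X = X := by
      apply ext'
      intro w
      rw [comp_ap]
      split_ifs with hw
      · rfl
      · exact (gk_hom h w hw).symm
    rw [this]; exact h
  · have : comp grade j X = 0 := by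
      apply ext'
      intro w
      rw [comp_ap]
      split_ifs with hw
      · exact gk_hom h w (by omega)
      · rfl
    rw [this]; exact Submodule.zero_mem _

theorem LieSer.of_inLie {X : Ser α} (h : NC.inLie grade X) : LieSer grade X := by
  obtain ⟨q, Y, hY, rfl⟩ := h
  exact LieSer.sum (Finset.Icc 1 q) Y fun i hi => LieSer.of_gk (hY i (Finset.mem_Icc.1 hi).1)

/-! ### exponentials -/

/-- exponential, as an element of the ring -/
noncomputable def sexp (Φ : Ser α) : Ser α := NC.exp Φ

/-- product of exponentials, as an element of the ring -/
noncomputable def sprod (l : List (List α → ℂ)) : Ser α := NC.prodExp l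

/-- normalized powers -/
noncomputable def en (Φ : Ser α) (n : ℕ) : Ser α := ((Nat.factorial n : ℂ))⁻¹ • Φ ^ n

/-- iterated brackets -/
noncomputable def an (Φ Y : Ser α) : ℕ → Ser α
  | 0 => Y
  | j + 1 => ((j : ℂ) + 2)⁻¹ • (Φ * an Φ Y j - an Φ Y j * Φ)

theorem exp_eq (Φ : Ser α) : sexp Φ = lim (en Φ) := by
  apply ext'
  intro w
  simp only [lim, en, ← pow_eq]
  rfl

theorem exp_deriv (hpos : ∀ a, 0 < grade a) {Φ : Ser α} (hΦ : LieSer grade Φ)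
    (δ : Ser α →ₗ[ℂ] Ser α) (hδ : ∀ x y, δ (x * y) = δ x * y + x * δ y)
    (hloc : ∀ (f g : Ser α) (w : List α),
      (∀ v : List α, v.length ≤ w.length → f v = g v) → δ f w = δ g w)
    (hY : LieSer grade (δ Φ)) :
    ∃ L : Ser α, LieSer grade L ∧ δ (sexp Φ) = L * sexp Φ := by
  have hL : ∀ j, LieSer grade (an Φ (δ Φ) j) := by
    intro j
    induction j with
    | zero => exact hY
    | succ j ih => exact (hΦ.lie ih).smul _
  have ho : ∀ j, ord j (an Φ (δ Φ) j) := by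
    intro j
    induction j with
    | zero => intro w hw; omega
    | succ j ih =>
      refine ord_smul _ (ord_sub ?_ (ord_mul ih hΦ.ord))
      rw [add_comm]
      exact ord_mul hΦ.ord ih
  have he : ∀ n, ord n (en Φ n) := fun n => ord_smul _ (ord_pow hΦ.ord n)
  have hk := key δ hδ Φ (en Φ) (an Φ (δ Φ)) (by simp [en]) (by
    intro n
    simp only [en]
    rw [mul_smul_comm, ← pow_succ', smul_smul, Nat.factorial_succ]
    congr 1
    have : ((n : ℂ) + 1) ≠ 0 := by exact_mod_cast Nat.succ_ne_zero n
    have : (n.factorial : ℂ) ≠ 0 := by exact_mod_cast Nat.factorial_ne_zero n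
    push_cast
    field_simp) rfl (by
    intro j
    simp only [an]
    have : ((j : ℂ) + 2) ≠ 0 := by exact_mod_cast Nat.succ_ne_zero (j + 1)
    rw [smul_smul, mul_inv_cancel₀ this, one_smul])
  refine ⟨lim (an Φ (δ Φ)), LieSer.lim hpos ho hL, ?_⟩
  rw [exp_eq, lim_mul ho he]
  apply ext'
  intro w
  have h1 : δ (lim (en Φ)) w = δ (∑ j ∈ Finset.range (w.length + 2), en Φ j) w := by
    apply hloc
    intro v hv
    rw [sum_ap]
    exact lim_ap he (by omega)
  have h0 : δ (en Φ 0) = 0 := by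
    have := hδ 1 1
    simp [en] at this ⊢
    exact this
  rw [h1, map_sum, Finset.sum_range_succ', h0, add_zero, sum_ap]
  exact Finset.sum_congr rfl fun n _ => by rw [hk]

theorem mul_congr {f f' g g' : Ser α} {w : List α}
    (hf : ∀ v : List α, v.length ≤ w.length → f v = f' v)
    (hg : ∀ v : List α, v.length ≤ w.length → g v = g' v) : (f * g) w = (f' * g') w := by
  rw [mul_ap, mul_ap]
  refine Finset.sum_congr rfl fun i _ => ?_
  rw [hf _ (by simp), hg _ (by simp)]

theorem exp_D (hpos : ∀ a, 0 < grade a) {Φ : Ser α} (hΦ : LieSer grade Φ) :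
    ∃ L : Ser α, LieSer grade L ∧ D grade (sexp Φ) = L * sexp Φ :=
  exp_deriv hpos hΦ (D grade) (D_mul grade)
    (fun f g w h => by rw [D_ap, D_ap, h w le_rfl]) hΦ.D

theorem exp_conj (hpos : ∀ a, 0 < grade a) {Φ M : Ser α} (hΦ : LieSer grade Φ)
    (hM : LieSer grade M) :
    ∃ L : Ser α, LieSer grade L ∧
      sexp Φ * M - M * sexp Φ = L * sexp Φ :=
  exp_deriv hpos hΦ (LinearMap.mulRight ℂ M - LinearMap.mulLeft ℂ M)
    (fun x y => by simp; noncomm_ring)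
    (fun f g w h => by
      simp only [LinearMap.sub_apply, LinearMap.mulRight_apply, LinearMap.mulLeft_apply, sub_ap]
      rw [mul_congr h (fun _ _ => rfl), mul_congr (f := M) (fun _ _ => rfl) h])
    (hΦ.lie hM)

theorem exp_nil (Φ : List α → ℂ) : NC.exp Φ [] = 1 := by
  simp [NC.exp, NC.pow, NC.one]

theorem prodExp_nil (l : List (List α → ℂ)) : NC.prodExp l [] = 1 := by
  induction l with
  | nil => rfl
  | cons X l ih => simp [NC.prodExp, ncmul_nil, ih, exp_nil]

theorem prodExp_D (hpos : ∀ a, 0 < grade a) (l : List (List α → ℂ))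
    (hl : ∀ X ∈ l, LieSer grade X) :
    ∃ L : Ser α, LieSer grade L ∧ D grade (sprod l) = L * sprod l := by
  induction l with
  | nil =>
    refine ⟨0, LieSer.zero, ?_⟩
    rw [zero_mul]
    apply ext'
    intro w
    rw [D_ap, zero_ap]
    cases w <;> simp [sprod, NC.prodExp, NC.one, NC.wgrade]
  | cons X l ih =>
    obtain ⟨L2, hL2, h2⟩ := ih fun Y hY => hl Y (List.mem_cons_of_mem _ hY)
    have hX := hl X List.mem_cons_self
    obtain ⟨L1, hL1, h1⟩ := exp_D hpos hX
    obtain ⟨L3, hL3, h3⟩ := exp_conj hpos hX hL2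
    refine ⟨L1 + L2 + L3, (hL1.add hL2).add hL3, ?_⟩
    have hc : sprod (X :: l) = sexp X * sprod l := rfl
    rw [hc]
    rw [D_mul, h1, h2]
    generalize sexp X = E at *
    generalize sprod l = P at *
    rw [add_mul, ← mul_assoc L3, ← h3]
    noncomm_ring

theorem main (hpos : ∀ a, 0 < grade a) {S E L M : Ser α}
    (hS : S [] = 1) (hE : E [] = 1) (hL : LieSer grade L) (hM : LieSer grade M)
    (hDS : D grade S = L * S) (hDE : D grade E = M * E) (hne : S ≠ E) :
    ∃ q : ℕ, 1 ≤ q ∧ ∃ Θ R : Ser α,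
      Θ ∈ NC.gk grade q ∧ Θ ≠ 0 ∧ R ∈ NC.Rset grade (q + 1) ∧ S = E + Θ + R := by
  classical
  have hex : ∃ q : ℕ, ∃ w : List α, NC.wgrade grade w = q ∧ (S - E) w ≠ 0 := by
    by_contra! hc
    exact hne (sub_eq_zero.1 (ext' fun w => hc _ w rfl))
  obtain ⟨w0, hw0, hF0⟩ := Nat.find_spec hex
  have hmin : ∀ w : List α, NC.wgrade grade w < Nat.find hex → (S - E) w = 0 := by
    intro w hw
    by_contra hc
    exact Nat.find_min hex hw ⟨w, rfl, hc⟩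
  generalize Nat.find hex = q at *
  have hq : 1 ≤ q := by
    by_contra hc
    have h1 := length_le_wgrade grade hpos w0
    have : w0 = [] := List.eq_nil_of_length_eq_zero (by omega)
    rw [this, sub_ap, hS, hE, sub_self] at hF0
    exact hF0 rfl
  have hK := hL.sub hM
  have hrel : D grade (S - E) = M * (S - E) + (L - M) * S := by
    rw [map_sub, hDS, hDE]
    noncomm_ring
  have hSE : S = E + (S - E) := by abel
  generalize S - E = F at *
  generalize L - M = K at *
  have hKF : ∀ n : ℕ, ∀ w : List α, w.length = n → NC.wgrade grade w ≤ q →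
      K w = (NC.wgrade grade w : ℂ) * F w := by
    intro n
    induction n using Nat.strong_induction_on with
    | _ n ih =>
      intro w hn hw
      have h1 : D grade F w = (M * F) w + (K * S) w := by rw [hrel]; rfl
      have h2 : (M * F) w = 0 := by
        rw [mul_ap]
        refine Finset.sum_eq_zero fun i hi => ?_
        by_cases h0 : w.take i = []
        · rw [h0, hM.nil, zero_mul]
        · have h3 := length_le_wgrade grade hpos (w.take i)
          have h4 := wgrade_split grade w i
          have h5 := List.length_pos_iff.2 h0
          rw [hmin (w.drop i) (by omega), mul_zero]
      have h3 : (K * S) w = K w := by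
        rw [mul_ap, Finset.sum_range_succ, List.take_length, List.drop_length, hS, mul_one,
          Finset.sum_eq_zero, zero_add]
        intro i hi
        have hi' := Finset.mem_range.1 hi
        have h4 := wgrade_split grade w i
        have h5 := length_le_wgrade grade hpos (w.drop i)
        rw [List.length_drop] at h5
        rw [ih i (by omega) (w.take i) (by rw [List.length_take]; omega) (by omega),
          hmin (w.take i) (by omega), mul_zero, zero_mul]
      rw [← D_ap, h1, h2, h3, zero_add]
  have hcomp : comp grade q F = (q : ℂ)⁻¹ • comp grade q K := by
    have hq0 : (q : ℂ) ≠ 0 := by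
      exact_mod_cast (by omega : q ≠ 0)
    apply ext'
    intro w
    rw [smul_ap, comp_ap, comp_ap]
    split_ifs with hw
    · rw [hKF _ w rfl hw.le, hw, inv_mul_cancel_left₀ hq0]
    · simp
  refine ⟨q, hq, comp grade q F, F - comp grade q F, ?_, ?_, ?_, ?_⟩
  · rw [hcomp]
    exact Submodule.smul_mem _ _ (hK q)
  · intro h
    apply hF0
    have := congrFun h w0
    rw [comp_ap, if_pos hw0] at this
    exact this
  · intro w hw
    rw [sub_ap, comp_ap]
    split_ifs with h
    · exact sub_self _
    · rw [hmin w (by omega), sub_zero]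
  · rw [add_assoc, add_sub_cancel]
    exact hSE

end NCAux

/-- (Theorem 1 of the paper.)  If `exp(Φ_J)⋯exp(Φ₁) ≠ exp(Ω)` for Lie
elements `Φ₁, …, Φ_J, Ω ∈ 𝔤`, then there are `q ≥ 1`, a nonzero `Θ ∈ 𝔤_q` and
`R ∈ ℛ_{q+1}` with `exp(Φ_J)⋯exp(Φ₁) = exp(Ω) + Θ + R`: the leading term of
the difference is a homogeneous Lie element. -/
theorem leading_error_term_is_lie {α : Type*} [DecidableEq α] [Fintype α]
    (grade : α → ℕ) (hpos : ∀ a, 0 < grade a)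
    (J : ℕ) (Φ : Fin J → List α → ℂ) (hΦ : ∀ j, NC.inLie grade (Φ j))
    (Ω : List α → ℂ) (hΩ : NC.inLie grade Ω)
    (hne : NC.scheme Φ ≠ NC.exp Ω) :
    ∃ q : ℕ, 1 ≤ q ∧ ∃ Θ R : List α → ℂ,
      Θ ∈ NC.gk grade q ∧ Θ ≠ 0 ∧ R ∈ NC.Rset grade (q + 1) ∧
      NC.scheme Φ = NC.exp Ω + Θ + R := by
  
  obtain ⟨L, hL, h1⟩ := NCAux.prodExp_D (grade := grade) hpos (List.ofFn Φ).reverse (by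
    intro X hX
    rw [List.mem_reverse, List.mem_ofFn] at hX
    obtain ⟨j, rfl⟩ := hX
    exact NCAux.LieSer.of_inLie (hΦ j))
  obtain ⟨M, hM, h2⟩ := NCAux.exp_D hpos (NCAux.LieSer.of_inLie hΩ)
  exact NCAux.main hpos (NCAux.prodExp_nil _) (NCAux.exp_nil Ω) hL hM h1 h2 hne
end

section
/- Let 𝔤 be the graded free Lie algebra on a finite alphabet and Φ_1,…,Φ_J, Ω ∈ 𝔤. If for every Lyndon word w of grade q ≤ p the coefficient of w in exp(Φ_J)⋯exp(Φ_1) − exp(Ω) vanishes, then exp(Φ_J)⋯exp(Φ_1) − exp(Ω) lies in the ideal of series of grade ≥ p+1. -/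
open scoped BigOperators

namespace NC

section shuffle
variable {α : Type*}

/-- Shuffle of two words, as a list of words. -/
def sh : List α → List α → List (List α)
  | [], v => [v]
  | a :: u, [] => [a :: u]
  | a :: u, b :: v => (sh u (b :: v)).map (List.cons a) ++ (sh (a :: u) v).map (List.cons b)
termination_by u v => u.length + v.length

theorem sh_nil_left (v : List α) : sh [] v = [v] := by simp [sh]

theorem sh_nil_right (u : List α) : sh u [] = [u] := by cases u <;> simp [sh]

theorem sh_cons (a b : α) (u v : List α) : sh (a :: u) (b :: v) =
    (sh u (b :: v)).map (List.cons a) ++ (sh (a :: u) v).map (List.cons b) := by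
  rw [sh]

theorem mem_sh_cons {a b : α} {u v z : List α} : z ∈ sh (a :: u) (b :: v) ↔
    (∃ y ∈ sh u (b :: v), a :: y = z) ∨ (∃ y ∈ sh (a :: u) v, b :: y = z) := by
  simp [sh_cons]

theorem cons_mem_left {a : α} {u v z : List α} (h : z ∈ sh u v) : a :: z ∈ sh (a :: u) v := by
  cases v with
  | nil => simp_all [sh_nil_right]
  | cons b v => exact mem_sh_cons.2 (Or.inl ⟨z, h, rfl⟩)

theorem cons_mem_right {b : α} {u v z : List α} (h : z ∈ sh u v) : b :: z ∈ sh u (b :: v) := by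
  cases u with
  | nil => simp_all [sh_nil_left]
  | cons a u => exact mem_sh_cons.2 (Or.inr ⟨z, h, rfl⟩)

theorem append_mem_sh (u v : List α) : u ++ v ∈ sh u v := by
  induction u with
  | nil => simp [sh_nil_left]
  | cons a u ih => exact cons_mem_left ih

theorem append_mem_sh' (u v : List α) : v ++ u ∈ sh u v := by
  induction v with
  | nil => simp [sh_nil_right]
  | cons a u ih => exact cons_mem_right ih

theorem perm_of_mem_sh : ∀ (u v : List α) {z : List α}, z ∈ sh u v → z.Perm (u ++ v)
  | [], v, z, h => by simp_all [sh_nil_left]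
  | a :: u, [], z, h => by simp_all [sh_nil_right]
  | a :: u, b :: v, z, h => by
    rcases mem_sh_cons.1 h with ⟨y, hy, rfl⟩ | ⟨y, hy, rfl⟩
    · exact (perm_of_mem_sh u (b :: v) hy).cons a
    · exact ((perm_of_mem_sh (a :: u) v hy).cons b).trans List.perm_middle.symm
termination_by u v => u.length + v.length

/-- Value of a series on a shuffle. -/
noncomputable def sS (S : List α → ℂ) (u v : List α) : ℂ := ((sh u v).map S).sum

theorem sS_nil_left (S : List α → ℂ) (v : List α) : sS S [] v = S v := by
  simp [sS, sh_nil_left]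

theorem sS_nil_right (S : List α → ℂ) (v : List α) : sS S v [] = S v := by
  simp [sS, sh_nil_right]

theorem sS_cons (S : List α → ℂ) (a b : α) (u v : List α) : sS S (a :: u) (b :: v) =
    sS (fun w => S (a :: w)) u (b :: v) + sS (fun w => S (b :: w)) (a :: u) v := by
  simp [sS, sh_cons, Function.comp_def]

theorem sS_add (S T : List α → ℂ) (u v : List α) : sS (S + T) u v = sS S u v + sS T u v := by
  exact List.sum_map_add

theorem sS_smul (c : ℂ) (S : List α → ℂ) (u v : List α) : sS (c • S) u v = c * sS S u v := by
  exact List.sum_map_mul_left (sh u v) S c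

theorem sS_sub (S T : List α → ℂ) (u v : List α) : sS (S - T) u v = sS S u v - sS T u v := by
  have : S - T = S + (-1 : ℂ) • T := by ext; simp [sub_eq_add_neg]
  rw [this, sS_add, sS_smul]; ring

theorem sS_zero (u v : List α) : sS (0 : List α → ℂ) u v = 0 := by
  exact List.sum_map_zero

theorem mul_cons (S T : List α → ℂ) (a : α) : (fun w => mul S T (a :: w)) =
    mul (fun w => S (a :: w)) T + S [] • (fun w => T (a :: w)) := by
  ext w
  simp [mul, Finset.sum_range_succ' _ (w.length + 1)]

theorem sS_mul : ∀ (u v : List α) (S T : List α → ℂ), sS (mul S T) u v =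
    ∑ i ∈ Finset.range (u.length + 1), ∑ j ∈ Finset.range (v.length + 1),
      sS S (u.take i) (v.take j) * sS T (u.drop i) (v.drop j)
  | [], v, S, T => by simp [sS_nil_left, mul]
  | a :: u, [], S, T => by simp [sS_nil_right, mul]
  | a :: u, b :: v, S, T => by
    rw [sS_cons, mul_cons, mul_cons, sS_add, sS_add, sS_smul, sS_smul,
      sS_mul u (b :: v), sS_mul (a :: u) v]
    simp only [List.length_cons]
    rw [Finset.sum_range_succ' _ (u.length + 1), Finset.sum_range_succ' _ (u.length + 1)]
    simp only [Finset.sum_range_succ' _ (v.length + 1)]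
    simp only [List.take_succ_cons, List.drop_succ_cons, List.take_zero, List.drop_zero,
      sS_nil_left, sS_nil_right, sS_cons, add_mul, Finset.sum_add_distrib]
    ring
termination_by u v => u.length + v.length

theorem sum_one_take (v : List α) (f : ℕ → ℂ) :
    ∑ j ∈ Finset.range (v.length + 1), one (v.take j) * f j = f 0 := by
  rw [Finset.sum_range_succ', Finset.sum_eq_zero]
  · simp [one]
  · intro i hi
    cases v with
    | nil => simp at hi
    | cons b v => simp [one]

theorem mul_one' (X : List α → ℂ) : mul X one = X := by
  ext w
  simp only [mul]
  rw [Finset.sum_range_succ, Finset.sum_eq_zero]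
  · simp [one]
  · intro i hi
    have : w.drop i ≠ [] := by simpa using hi
    obtain ⟨b, v, h⟩ := List.exists_cons_of_ne_nil this
    simp [h, one]

/-- primitive series -/
def Prim (X : List α → ℂ) : Prop := ∀ u v, sS X u v = X u * one v + one u * X v

/-- grouplike series -/
def Grouplike (X : List α → ℂ) : Prop := X [] = 1 ∧ ∀ u v, sS X u v = X u * X v

theorem Prim.nil {X : List α → ℂ} (h : Prim X) : X [] = 0 := by
  have := h [] []
  simp [sS_nil_left, one] at this
  exact this

theorem Prim.mul_left {X : List α → ℂ} (h : Prim X) (Y : List α → ℂ) (u v : List α) :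
    sS (mul X Y) u v = ∑ i ∈ Finset.range (u.length + 1), X (u.take i) * sS Y (u.drop i) v +
      ∑ j ∈ Finset.range (v.length + 1), X (v.take j) * sS Y u (v.drop j) := by
  rw [sS_mul]
  simp only [h _ _, add_mul, Finset.sum_add_distrib]
  congr 1
  · refine Finset.sum_congr rfl fun i _ => ?_
    have := sum_one_take v (fun j => X (u.take i) * sS Y (u.drop i) (v.drop j))
    simp only [List.drop_zero] at this
    rw [← this]
    exact Finset.sum_congr rfl fun j _ => by ring
  · rw [Finset.sum_comm]
    refine Finset.sum_congr rfl fun j _ => ?_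
    have := sum_one_take u (fun i => X (v.take j) * sS Y (u.drop i) (v.drop j))
    simp only [List.drop_zero] at this
    rw [← this]
    exact Finset.sum_congr rfl fun j _ => by ring

theorem Prim.mul_prim {X Y : List α → ℂ} (hX : Prim X) (hY : Prim Y) (u v : List α) :
    sS (mul X Y) u v = mul X Y u * one v + X u * Y v + Y u * X v + one u * mul X Y v := by
  rw [hX.mul_left]
  simp only [hY _ _, mul_add, Finset.sum_add_distrib, ← mul_assoc]
  have e : ∀ w : List α, ∑ i ∈ Finset.range (w.length + 1), X (w.take i) * one (w.drop i) = X w :=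
    fun w => congrFun (mul_one' X) w
  rw [← Finset.sum_mul, ← Finset.sum_mul, e]
  have h1 : ∑ x ∈ Finset.range (v.length + 1), X (List.take x v) * Y u * one (List.drop x v)
      = Y u * X v := by
    rw [← e v, Finset.mul_sum]
    exact Finset.sum_congr rfl fun j _ => by ring
  have h2 : ∑ x ∈ Finset.range (v.length + 1), X (List.take x v) * one u * Y (List.drop x v)
      = one u * mul X Y v := by
    simp only [mul]
    rw [Finset.mul_sum]
    exact Finset.sum_congr rfl fun j _ => by ring
  rw [h1, h2]
  simp only [mul]
  ring

theorem Prim.lie {X Y : List α → ℂ} (hX : Prim X) (hY : Prim Y) : Prim (lie X Y) := by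
  intro u v
  simp only [NC.lie]
  rw [sS_sub, hX.mul_prim hY, hY.mul_prim hX]
  simp only [Pi.sub_apply]
  ring

theorem sS_eq_zero {S : List α → ℂ} {u v : List α}
    (h : ∀ z, z.length = u.length + v.length → S z = 0) : sS S u v = 0 := by
  apply List.sum_eq_zero
  intro x hx
  obtain ⟨z, hz, rfl⟩ := List.mem_map.1 hx
  exact h z (by simpa using (perm_of_mem_sh u v hz).length_eq)

theorem Prim.gen [DecidableEq α] (a : α) : Prim (gen a) := by
  intro u v
  cases u with
  | nil => simp [sS_nil_left, one, NC.gen]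
  | cons b u =>
    cases v with
    | nil => simp [sS_nil_right, one, NC.gen]
    | cons c v =>
      rw [sS_eq_zero]
      · simp [one]
      · intro z hz
        simp only [NC.gen]
        rw [if_neg]
        rintro rfl
        simp at hz
        omega

/-- primitive series form a submodule -/
def primSub (α : Type*) : Submodule ℂ (List α → ℂ) where
  carrier := {X | Prim X}
  add_mem' := by
    intro X Y hX hY u v
    rw [sS_add, hX u v, hY u v]
    simp only [Pi.add_apply]; ring
  zero_mem' := by
    intro u v
    simp [sS_zero]
  smul_mem' := by
    intro c X hX u v
    rw [sS_smul, hX u v]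
    simp only [Pi.smul_apply, smul_eq_mul]; ring

theorem IsPure.prim [DecidableEq α] {grade : α → ℕ} {X : List α → ℂ} {k : ℕ}
    (h : IsPure grade X k) : Prim X := by
  induction h with
  | gen a => exact Prim.gen a
  | bracket _ _ h1 h2 => exact h1.lie h2

theorem inLie.prim [DecidableEq α] {grade : α → ℕ} {X : List α → ℂ}
    (h : inLie grade X) : Prim X := by
  obtain ⟨q, Y, hY, rfl⟩ := h
  have : ∑ k ∈ Finset.Icc 1 q, Y k ∈ primSub α := by
    refine Submodule.sum_mem _ fun k hk => ?_
    have h1 : gk grade k ≤ primSub α := Submodule.span_le.2 fun Z hZ => IsPure.prim hZ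
    exact h1 (hY k (Finset.mem_Icc.1 hk).1)
  exact this

theorem Grouplike.one : Grouplike (one : List α → ℂ) := by
  refine ⟨rfl, fun u v => ?_⟩
  cases u with
  | nil => simp [sS_nil_left, NC.one]
  | cons b u =>
    rw [sS_eq_zero]
    · simp [NC.one]
    · intro z hz
      cases z with
      | nil => simp at hz; omega
      | cons => rfl

theorem Grouplike.mul {X Y : List α → ℂ} (hX : Grouplike X) (hY : Grouplike Y) : Grouplike (mul X Y) := by
  refine ⟨by simp [NC.mul, hX.1, hY.1], fun u v => ?_⟩
  rw [sS_mul]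
  simp only [NC.mul]
  rw [Finset.sum_mul_sum]
  refine Finset.sum_congr rfl fun i _ => Finset.sum_congr rfl fun j _ => ?_
  rw [hX.2, hY.2]; ring

/-- divided powers -/
noncomputable def dp (X : List α → ℂ) (n : ℕ) : List α → ℂ :=
  ((Nat.factorial n : ℂ))⁻¹ • pow X n

theorem mul_smul' (c : ℂ) (X Y : List α → ℂ) : mul X (c • Y) = c • mul X Y := by
  ext w
  simp only [mul, Pi.smul_apply, smul_eq_mul, Finset.mul_sum]
  exact Finset.sum_congr rfl fun j _ => by ring

theorem mul_dp (X : List α → ℂ) (n : ℕ) : mul X (dp X n) = ((n : ℂ) + 1) • dp X (n + 1) := by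
  have h : (n : ℂ) + 1 ≠ 0 := by exact_mod_cast Nat.succ_ne_zero n
  have h' : (Nat.factorial n : ℂ) ≠ 0 := by exact_mod_cast Nat.factorial_ne_zero n
  rw [dp, dp, mul_smul', pow, smul_smul]
  congr 1
  rw [Nat.factorial_succ]; push_cast; field_simp

theorem sS_dp {X : List α → ℂ} (hX : Prim X) : ∀ (n : ℕ) (u v : List α), sS (dp X n) u v =
    ∑ p ∈ Finset.HasAntidiagonal.antidiagonal n, dp X p.1 u * dp X p.2 v := by
  intro n
  induction n with
  | zero =>
    intro u v
    have : dp X 0 = one := by simp [dp, pow]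
    simp [this, Grouplike.one.2]
  | succ n ih =>
    intro u v
    have h : (n : ℂ) + 1 ≠ 0 := by exact_mod_cast Nat.succ_ne_zero n
    have key := hX.mul_left (dp X n) u v
    rw [mul_dp, sS_smul] at key
    apply mul_left_cancel₀ h
    rw [key]
    have m : ∀ k (w : List α), ∑ i ∈ Finset.range (w.length + 1),
        X (w.take i) * dp X k (w.drop i) = ((k : ℂ) + 1) * dp X (k + 1) w :=
      fun k w => congrFun (mul_dp X k) w
    have h1 : ∑ i ∈ Finset.range (u.length + 1), X (u.take i) * sS (dp X n) (u.drop i) v =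
        ∑ p ∈ Finset.HasAntidiagonal.antidiagonal (n + 1), (p.1 : ℂ) * (dp X p.1 u * dp X p.2 v) := by
      rw [Finset.Nat.sum_antidiagonal_succ]
      simp only [ih, Finset.mul_sum]
      rw [Finset.sum_comm]
      simp only [Nat.cast_zero, zero_mul, zero_add]
      refine Finset.sum_congr rfl fun p _ => ?_
      push_cast
      rw [← mul_assoc, ← m, Finset.sum_mul]
      exact Finset.sum_congr rfl fun j _ => by ring
    have h2 : ∑ j ∈ Finset.range (v.length + 1), X (v.take j) * sS (dp X n) u (v.drop j) =
        ∑ p ∈ Finset.HasAntidiagonal.antidiagonal (n + 1), (p.2 : ℂ) * (dp X p.1 u * dp X p.2 v) := by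
      rw [Finset.Nat.sum_antidiagonal_succ']
      simp only [ih, Finset.mul_sum]
      rw [Finset.sum_comm]
      simp only [Nat.cast_zero, zero_mul, zero_add]
      refine Finset.sum_congr rfl fun p _ => ?_
      push_cast
      rw [mul_left_comm, ← m, Finset.mul_sum]
      exact Finset.sum_congr rfl fun j _ => by ring
    rw [h1, h2, ← Finset.sum_add_distrib, Finset.mul_sum]
    refine Finset.sum_congr rfl fun p hp => ?_
    rw [← add_mul]
    congr 1
    exact_mod_cast Finset.HasAntidiagonal.mem_antidiagonal.1 hp

theorem pow_eq_zero' {X : List α → ℂ} (hX : X [] = 0) : ∀ (n : ℕ) (w : List α),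
    w.length < n → pow X n w = 0 := by
  intro n
  induction n with
  | zero => intro w h; simp at h
  | succ n ih =>
    intro w hw
    simp only [pow, mul]
    refine Finset.sum_eq_zero fun i hi => ?_
    rcases Nat.eq_zero_or_pos i with rfl | h
    · simp [hX]
    · simp only [Finset.mem_range] at hi
      rw [ih, mul_zero]
      simp only [List.length_drop]; omega

theorem exp_eq {X : List α → ℂ} (hX : X [] = 0) (N : ℕ) (w : List α) (h : w.length + 1 ≤ N) :
    exp X w = ∑ k ∈ Finset.range N, dp X k w := by
  rw [exp]
  refine Finset.sum_subset (Finset.range_mono h) fun k _ hk => ?_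
  rw [pow_eq_zero' hX, mul_zero]
  simp only [Finset.mem_range] at hk; omega

theorem dp_eq_zero {X : List α → ℂ} (hX : X [] = 0) (n : ℕ) (w : List α)
    (h : w.length < n) : dp X n w = 0 := by
  simp [dp, pow_eq_zero' hX n w h]

theorem sS_sum (s : Finset ℕ) (f : ℕ → List α → ℂ) (u v : List α) :
    sS (∑ k ∈ s, f k) u v = ∑ k ∈ s, sS (f k) u v := by
  classical
  induction s using Finset.induction_on with
  | empty => simp [sS_zero]
  | insert a s ha ih => rw [Finset.sum_insert ha, Finset.sum_insert ha, sS_add, ih]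

theorem Prim.exp {X : List α → ℂ} (hX : Prim X) : Grouplike (exp X) := by
  refine ⟨by simp [NC.exp, pow, NC.one], fun u v => ?_⟩
  have h0 := hX.nil
  have e : sS (NC.exp X) u v =
      sS (∑ k ∈ Finset.range (u.length + v.length + 1), dp X k) u v := by
    simp only [sS]
    congr 1
    refine List.map_congr_left fun z hz => ?_
    rw [exp_eq h0 (u.length + v.length + 1), Finset.sum_apply]
    have := (perm_of_mem_sh u v hz).length_eq
    simp at this; omega
  rw [e, sS_sum, exp_eq h0 _ u le_rfl, exp_eq h0 _ v le_rfl, Finset.sum_mul_sum,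
    ← Finset.sum_product',
    ← Finset.sum_fiberwise_of_maps_to (g := fun p : ℕ × ℕ => p.1 + p.2)
      (t := Finset.range (u.length + v.length + 1))]
  · refine Finset.sum_congr rfl fun k _ => ?_
    rw [sS_dp hX]
    symm
    refine Finset.sum_subset ?_ ?_
    · intro p hp
      simp at hp
      simp [hp.2]
    · intro p hp hp'
      simp only [Finset.mem_filter, Finset.mem_product, Finset.mem_range,
        Finset.HasAntidiagonal.mem_antidiagonal] at hp hp'
      by_cases h1 : u.length < p.1
      · rw [dp_eq_zero h0 _ _ h1, zero_mul]
      · have h2 : v.length < p.2 := by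
          by_contra h2
          exact hp' ⟨⟨by omega, by omega⟩, hp⟩
        rw [dp_eq_zero h0 _ _ h2, mul_zero]
  · intro p hp
    simp only [Finset.mem_product, Finset.mem_range] at hp ⊢
    omega

theorem Grouplike.prodExp : ∀ (l : List (List α → ℂ)), (∀ X ∈ l, Prim X) → Grouplike (prodExp l)
  | [], _ => Grouplike.one
  | X :: l, h => Grouplike.mul (h X (by simp)).exp (Grouplike.prodExp l fun Y hY => h Y (by simp [hY]))

end shuffle

section lyndon
variable {α : Type*} [LinearOrder α]

theorem cons_le_cons' {a b : α} {u v : List α} :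
    a :: u ≤ b :: v ↔ a < b ∨ a = b ∧ u ≤ v := by
  rw [le_iff_lt_or_eq, le_iff_lt_or_eq, List.cons_lt_cons_iff, List.cons.injEq]
  tauto

theorem shuffle_exchange : ∀ (n : ℕ) (s u v z : List α), s.length + u.length + v.length = n →
    v ≤ u → z ∈ sh (s ++ u) v → ∃ y ∈ sh u (s ++ v), z ≤ y := by
  intro n
  induction n with
  | zero =>
    intro s u v z hn _ hz
    have hs : s = [] := List.length_eq_zero_iff.1 (by omega)
    subst hs
    exact ⟨z, hz, le_rfl⟩
  | succ n ih =>
    intro s u v z hn hvu hz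
    cases s with
    | nil => exact ⟨z, hz, le_rfl⟩
    | cons a s =>
      cases v with
      | nil =>
        rw [sh_nil_right] at hz
        refine ⟨_, append_mem_sh' u (a :: s ++ []), ?_⟩
        simp_all
      | cons c v =>
        cases u with
        | nil => exact absurd hvu (by simp)
        | cons d u =>
          simp only [List.length_cons] at hn
          rcases mem_sh_cons.1 hz with ⟨y, hy, rfl⟩ | ⟨y, hy, rfl⟩
          · obtain ⟨x, hx, hyx⟩ := ih s (d :: u) (c :: v) y (by simp; omega) hvu hy
            exact ⟨a :: x, cons_mem_right hx, cons_le_cons'.2 (Or.inr ⟨rfl, hyx⟩)⟩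
          · rcases cons_le_cons'.1 hvu with h | ⟨rfl, h⟩
            · exact ⟨d :: (u ++ (a :: s ++ c :: v)), cons_mem_left (append_mem_sh _ _),
                cons_le_cons'.2 (Or.inl h)⟩
            · obtain ⟨x, hx, hyx⟩ := ih (a :: s ++ [c]) u v y (by simp; omega) h (by simpa using hy)
              exact ⟨c :: x, cons_mem_left (by simpa using hx),
                cons_le_cons'.2 (Or.inr ⟨rfl, hyx⟩)⟩

theorem shuffle_le (v : List α) : ∀ (u : List α),
    (∀ x, x ≠ [] → x <:+ u → v ≤ x) → ∀ z ∈ sh u v, z ≤ u ++ v := by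
  intro u
  induction u with
  | nil => intro _ z hz; simp_all [sh_nil_left]
  | cons a u ih =>
    intro h z hz
    have ih' := ih fun x hx hxu => h x hx (hxu.trans (List.suffix_cons a u))
    have h0 := h (a :: u) (by simp) List.suffix_rfl
    cases v with
    | nil => simp_all [sh_nil_right]
    | cons c v =>
      rcases mem_sh_cons.1 hz with ⟨y, hy, rfl⟩ | ⟨y, hy, rfl⟩
      · exact cons_le_cons'.2 (Or.inr ⟨rfl, ih' y hy⟩)
      · rcases cons_le_cons'.1 h0 with h1 | ⟨rfl, h1⟩
        · exact cons_le_cons'.2 (Or.inl h1)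
        · obtain ⟨x, hx, hyx⟩ := shuffle_exchange _ [c] u v y rfl h1 hy
          exact cons_le_cons'.2 (Or.inr ⟨rfl, hyx.trans (ih' x hx)⟩)

theorem le_append_cases : ∀ (x v y : List α), v ≤ x ++ y →
    v ≤ x ∨ ∃ s, v = x ++ s ∧ s ≤ y
  | [], v, y, h => Or.inr ⟨v, rfl, h⟩
  | a :: x, [], y, h => Or.inl (le_of_lt (List.nil_lt_cons a x))
  | a :: x, b :: v, y, h => by
    rcases cons_le_cons'.1 h with h1 | ⟨rfl, h1⟩
    · exact Or.inl (cons_le_cons'.2 (Or.inl h1))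
    · rcases le_append_cases x v y h1 with h2 | ⟨s, rfl, hs⟩
      · exact Or.inl (cons_le_cons'.2 (Or.inr ⟨rfl, h2⟩))
      · exact Or.inr ⟨s, rfl, hs⟩

theorem exists_split (w : List α) (h0 : w ≠ []) (hw : ¬ Lyndon w) :
    ∃ u v, u ≠ [] ∧ v ≠ [] ∧ w = u ++ v ∧ ∀ z ∈ sh u v, z ≤ w := by
  have hl : 0 < w.length := List.length_pos_iff.2 h0
  obtain ⟨i, hi, hmin⟩ := Finset.exists_min_image (Finset.range w.length) (fun i => w.drop i)
    ⟨0, by simpa using hl⟩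
  simp only [Finset.mem_range] at hi hmin
  have hi0 : i ≠ 0 := by
    rintro rfl
    refine hw ⟨h0, fun j hj hjl => lt_of_le_of_ne (by simpa using hmin j hjl) fun e => ?_⟩
    have := congrArg List.length e
    simp at this; omega
  have hsuf : ∀ x, x ≠ [] → x <:+ w → w.drop i ≤ x := by
    intro x hx hxw
    have hx' := List.length_pos_iff.2 hx
    rw [List.suffix_iff_eq_drop.1 hxw]
    exact hmin _ (by omega)
  have hv : w.drop i ≠ [] := by simpa using hi
  refine ⟨w.take i, w.drop i, by simp [hi0, h0], hv, by simp, ?_⟩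
  have := shuffle_le (w.drop i) (w.take i) ?_
  · simpa using this
  · intro x hx hxu
    have h1 : x ++ w.drop i <:+ w := by
      obtain ⟨t, ht⟩ := hxu
      exact ⟨t, by rw [← List.append_assoc, ht, List.take_append_drop]⟩
    rcases le_append_cases x _ _ (hsuf _ (by simp [hx]) h1) with h2 | ⟨s, hs, hsv⟩
    · exact h2
    · rcases eq_or_ne s [] with rfl | hs0
      · rw [List.append_nil] at hs; exact hs.le
      · have h3 : s <:+ w := List.IsSuffix.trans (⟨x, hs.symm⟩ : s <:+ w.drop i) (List.drop_suffix i w)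
        have h4 := le_antisymm hsv (hsuf s hs0 h3)
        have h5 := congrArg List.length hs
        rw [h4, List.length_append] at h5
        have h6 := List.length_pos_iff.2 hx
        omega

theorem Grouplike.eq_of_lyndon [Fintype α] (grade : α → ℕ) (p : ℕ) {S T : List α → ℂ}
    (hS : Grouplike S) (hT : Grouplike T)
    (h : ∀ w : List α, Lyndon w → wgrade grade w ≤ p → (S - T) w = 0) :
    ∀ (n : ℕ) (w : List α), w.length = n → wgrade grade w ≤ p → (S - T) w = 0 := by
  intro n
  induction n using Nat.strong_induction_on with
  | _ n ih =>
    by_contra! hcon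
    obtain ⟨w0, hw0⟩ := hcon
    obtain ⟨w, ⟨hwn, hwp, hwne⟩, hmin⟩ := Set.exists_min_image
      {w : List α | w.length = n ∧ wgrade grade w ≤ p ∧ (S - T) w ≠ 0} id
      ((List.finite_length_eq α n).subset fun w hw => hw.1) ⟨w0, hw0⟩
    have hne : w ≠ [] := by
      rintro rfl
      exact hwne (by simp [hS.1, hT.1])
    have hnl : ¬ Lyndon w := fun hl => hwne (h w hl hwp)
    obtain ⟨u, v, hu, hv, rfl, hle⟩ := exists_split w hne hnl
    have hu' := List.length_pos_iff.2 hu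
    have hv' := List.length_pos_iff.2 hv
    have hg : wgrade grade u + wgrade grade v ≤ p := by simpa [wgrade] using hwp
    simp only [List.length_append] at hwn
    have eu := ih u.length (by omega) u rfl (by omega)
    have ev := ih v.length (by omega) v rfl (by omega)
    simp only [Pi.sub_apply, sub_eq_zero] at eu ev
    have hz : sS (S - T) u v = 0 := by
      rw [sS_sub, hS.2, hT.2, eu, ev, sub_self]
    rw [sS, Finset.sum_list_map_count, Finset.sum_eq_single (u ++ v)] at hz
    · rw [nsmul_eq_mul, mul_eq_zero] at hz
      rcases hz with hz | hz
      · have hz1 := (@List.count_eq_zero _ instBEqOfDecidableEq inferInstance _ _).1 (Nat.cast_eq_zero.1 hz)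
        exact hz1 (append_mem_sh u v)
      · exact hwne hz
    · intro z hz hzw
      rw [List.mem_toFinset] at hz
      have hp := perm_of_mem_sh u v hz
      by_cases hz0 : (S - T) z = 0
      · rw [hz0, smul_zero]
      · have hgz : wgrade grade z = wgrade grade (u ++ v) := (hp.map grade).sum_eq
        have := hmin z ⟨by simpa [hwn] using hp.length_eq, hgz ▸ hwp, hz0⟩
        exact absurd (le_antisymm (hle z hz) this) hzw
    · intro hz
      exact absurd (List.mem_toFinset.2 (append_mem_sh u v)) hz

end lyndon

end NC

/-- (Order conditions, Theorem 3 of the paper.)  If for every Lyndon word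
`w` of grade `≤ p` the coefficient of `w` in `exp(Φ_J)⋯exp(Φ₁) − exp(Ω)` vanishes, then
`exp(Φ_J)⋯exp(Φ₁) − exp(Ω) ∈ ℛ_{p+1}`. -/
theorem order_conditions {α : Type*} [LinearOrder α] [Fintype α]
    (grade : α → ℕ) (hpos : ∀ a, 0 < grade a) (p : ℕ)
    (J : ℕ) (Φ : Fin J → List α → ℂ) (hΦ : ∀ j, NC.inLie grade (Φ j))
    (Ω : List α → ℂ) (hΩ : NC.inLie grade Ω)
    (hoc : ∀ w : List α, NC.Lyndon w → NC.wgrade grade w ≤ p →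
      (NC.scheme Φ - NC.exp Ω) w = 0) :
    (NC.scheme Φ - NC.exp Ω) ∈ NC.Rset grade (p + 1) := by
  have h1 : NC.Grouplike (NC.scheme Φ) := by
    refine NC.Grouplike.prodExp _ fun X hX => ?_
    rw [List.mem_reverse, List.mem_ofFn] at hX
    obtain ⟨j, rfl⟩ := hX
    exact (hΦ j).prim
  intro w hw
  exact NC.Grouplike.eq_of_lyndon grade p h1 hΩ.prim.exp hoc w.length w rfl (by omega)
end

section
/- In the formal power series algebra in two non-commuting variables A, B, set S = exp(bB)·exp(aA)·exp(cB + d[B,[A,B]])·exp(aA)·exp(bB). The four equations 2a − 1 = 0, 2b + c − 1 = 0, 2a²b + a²c/2 − 1/6 = 0, and ab² + ac²/2 + abc − d − 1/6 = 0 have the unique solution a = 1/2, b = 1/6, c = 2/3, d = 1/72, and with these values the coefficients of the words A, B, AAB, ABB in S − exp(A+B) all vanish. -/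
open scoped BigOperators

/-- The generalized splitting scheme
`S = exp(bB)·exp(aA)·exp(cB + d[B,[A,B]])·exp(aA)·exp(bB)` over `{A, B}`
(`A = false`, `B = true`). -/
noncomputable def genSplit (a b c d : ℂ) : List Bool → ℂ :=
  NC.mul (NC.exp (b • NC.gen true))
    (NC.mul (NC.exp (a • NC.gen false))
      (NC.mul (NC.exp (c • NC.gen true +
          d • NC.lie (NC.gen true) (NC.lie (NC.gen false) (NC.gen true))))
        (NC.mul (NC.exp (a • NC.gen false)) (NC.exp (b • NC.gen true)))))

section Helpers
variable {α : Type*}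

theorem mul_w0 (X Y : List α → ℂ) : NC.mul X Y [] = X [] * Y [] := by
  simp [NC.mul]

theorem mul_w1 (X Y : List α → ℂ) (p : α) :
    NC.mul X Y [p] = X [] * Y [p] + X [p] * Y [] := by
  simp [NC.mul, Finset.sum_range_succ]

theorem mul_w2 (X Y : List α → ℂ) (p q : α) :
    NC.mul X Y [p, q] = X [] * Y [p, q] + X [p] * Y [q] + X [p, q] * Y [] := by
  simp [NC.mul, Finset.sum_range_succ]

theorem mul_w3 (X Y : List α → ℂ) (p q r : α) :
    NC.mul X Y [p, q, r] =
      X [] * Y [p, q, r] + X [p] * Y [q, r] + X [p, q] * Y [r] + X [p, q, r] * Y [] := by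
  simp [NC.mul, Finset.sum_range_succ]

theorem exp_w0 (X : List α → ℂ) : NC.exp X [] = 1 := by
  simp [NC.exp, NC.pow, NC.one]

theorem exp_w1 (X : List α → ℂ) (h : X [] = 0) (p : α) : NC.exp X [p] = X [p] := by
  simp [NC.exp, NC.pow, NC.one, Finset.sum_range_succ, mul_w1, h]

theorem exp_w2 (X : List α → ℂ) (h : X [] = 0) (p q : α) :
    NC.exp X [p, q] = X [p, q] + X [p] * X [q] / 2 := by
  simp [NC.exp, NC.pow, NC.one, Finset.sum_range_succ, mul_w0, mul_w1, mul_w2, h, Nat.factorial]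
  ring

theorem exp_w3 (X : List α → ℂ) (h : X [] = 0) (p q r : α) :
    NC.exp X [p, q, r] = X [p, q, r] + (X [p] * X [q, r] + X [p, q] * X [r]) / 2
      + X [p] * X [q] * X [r] / 6 := by
  simp [NC.exp, NC.pow, NC.one, Finset.sum_range_succ, mul_w0, mul_w1, mul_w2, mul_w3, h,
    Nat.factorial]
  ring

end Helpers

/-- The four order conditions `2a − 1 = 0`, `2b + c − 1 = 0`,
`2a²b + a²c/2 − 1/6 = 0`, `ab² + ac²/2 + abc − d − 1/6 = 0` have the unique solution
`a = 1/2`, `b = 1/6`, `c = 2/3`, `d = 1/72`; and with these values the coefficients of the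
words `A`, `B`, `AAB`, `ABB` in `S − exp(A+B)` all vanish. -/
theorem genSplit_order_conditions :
    (∀ a b c d : ℂ,
      (2 * a - 1 = 0 ∧ 2 * b + c - 1 = 0 ∧
        2 * a ^ 2 * b + a ^ 2 * c / 2 - 1 / 6 = 0 ∧
        a * b ^ 2 + a * c ^ 2 / 2 + a * b * c - d - 1 / 6 = 0)
      ↔ (a = 1 / 2 ∧ b = 1 / 6 ∧ c = 2 / 3 ∧ d = 1 / 72)) ∧
    ((genSplit (1 / 2) (1 / 6) (2 / 3) (1 / 72)
        - NC.exp (NC.gen false + NC.gen true)) [false] = 0 ∧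
     (genSplit (1 / 2) (1 / 6) (2 / 3) (1 / 72)
        - NC.exp (NC.gen false + NC.gen true)) [true] = 0 ∧
     (genSplit (1 / 2) (1 / 6) (2 / 3) (1 / 72)
        - NC.exp (NC.gen false + NC.gen true)) [false, false, true] = 0 ∧
     (genSplit (1 / 2) (1 / 6) (2 / 3) (1 / 72)
        - NC.exp (NC.gen false + NC.gen true)) [false, true, true] = 0) := by
  refine ⟨?_, ?_, ?_, ?_, ?_⟩
  · intro a b c d
    constructor
    · rintro ⟨h1, h2, h3, h4⟩
      have ha : a = 1 / 2 := by linear_combination h1 / 2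
      subst ha
      have hb : b = 1 / 6 := by linear_combination 4 * h3 - h2 / 2
      subst hb
      have hc : c = 2 / 3 := by linear_combination h2
      subst hc
      refine ⟨rfl, rfl, rfl, ?_⟩
      linear_combination -h4
    · rintro ⟨rfl, rfl, rfl, rfl⟩
      norm_num
  all_goals
    simp [genSplit, mul_w0, mul_w1, mul_w2, mul_w3, exp_w0, exp_w1, exp_w2, exp_w3,
      NC.gen, NC.lie]
    try norm_num
end
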